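/- For every κ > 0 there exists a constant C(κ) > 0 such that for all smooth compactly supported maps u, u₁ : ℝ² → ℝ² with u divergence-free, |b(u,u₁,u)| ≤ κ ‖∇u‖₂² + C(κ) ‖u₁‖₂² ‖∇u₁‖₂² ‖u‖₂². -/

import Mathlib

open MeasureTheory

noncomputable section

/-- Partial derivative of a real-valued function on `ℝ²` in the `i`-th coordinate direction. -/
def pderivE (g : (Fin 2 → ℝ) → ℝ) (i : Fin 2) (x : Fin 2 → ℝ) : ℝ :=
  fderiv ℝ g x (Pi.single i 1)

/-- The Navier–Stokes trilinear form
`b(u,v,w) = ∑ i j, ∫ u_i ∂_i v_j w_j`. -/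
def formB (u v w : (Fin 2 → ℝ) → (Fin 2 → ℝ)) : ℝ :=
  ∑ i : Fin 2, ∑ j : Fin 2, ∫ x : Fin 2 → ℝ, u x i * pderivE (fun y => v y j) i x * w x j

/-- The Ericksen stress trilinear form
`m(θ₁,θ₂,u) = −∑ i j k, ∫ ∂_i θ₁^k ∂_j θ₂^k ∂_j u^i`. -/
def formM (t1 t2 u : (Fin 2 → ℝ) → (Fin 2 → ℝ)) : ℝ :=
  -∑ i : Fin 2, ∑ j : Fin 2, ∑ k : Fin 2, ∫ x : Fin 2 → ℝ,
    pderivE (fun y => t1 y k) i x * pderivE (fun y => t2 y k) j x *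
      pderivE (fun y => u y i) j x

/-- `u` is divergence-free: `∂₁u₁ + ∂₂u₂ = 0` everywhere. -/
def DivergenceFree (u : (Fin 2 → ℝ) → (Fin 2 → ℝ)) : Prop :=
  ∀ x, (∑ i : Fin 2, pderivE (fun y => u y i) i x) = 0

/-- The `L²` norm of an `ℝ²`-valued map. -/
def l2norm (g : (Fin 2 → ℝ) → (Fin 2 → ℝ)) : ℝ :=
  (∫ x : Fin 2 → ℝ, ∑ k : Fin 2, (g x k) ^ 2) ^ (1/2 : ℝ)

/-- The `L²` norm of the gradient of an `ℝ²`-valued map. -/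
def gradNorm (g : (Fin 2 → ℝ) → (Fin 2 → ℝ)) : ℝ :=
  (∫ x : Fin 2 → ℝ, ∑ i : Fin 2, ∑ k : Fin 2, (pderivE (fun y => g y k) i x) ^ 2) ^ (1/2 : ℝ)

/-- The `L²` norm of a real-valued function. -/
def l2normR (g : (Fin 2 → ℝ) → ℝ) : ℝ :=
  (∫ x : Fin 2 → ℝ, (g x) ^ 2) ^ (1/2 : ℝ)

/-- The `L²` norm of the gradient of a real-valued function. -/
def gradNormR (g : (Fin 2 → ℝ) → ℝ) : ℝ :=
  (∫ x : Fin 2 → ℝ, ∑ i : Fin 2, (pderivE g i x) ^ 2) ^ (1/2 : ℝ)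

/-- The `k`-th component of the (componentwise) Laplacian `Δg_k = ∂₁₁ g_k + ∂₂₂ g_k`. -/
def lapComp (g : (Fin 2 → ℝ) → (Fin 2 → ℝ)) (k : Fin 2) (x : Fin 2 → ℝ) : ℝ :=
  ∑ i : Fin 2, pderivE (pderivE (fun y => g y k) i) i x

/-- The `L²` norm of the componentwise Laplacian. -/
def lapNorm (g : (Fin 2 → ℝ) → (Fin 2 → ℝ)) : ℝ :=
  (∫ x : Fin 2 → ℝ, ∑ k : Fin 2, (lapComp g k x) ^ 2) ^ (1/2 : ℝ)

/-- The `L^{4N+2}` norm of an `ℝ²`-valued map (written using `|v|^{4N+2} = (|v|²)^{2N+1}`). -/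
def lqNorm (N : ℕ) (g : (Fin 2 → ℝ) → (Fin 2 → ℝ)) : ℝ :=
  (∫ x : Fin 2 → ℝ, (∑ k : Fin 2, (g x k) ^ 2) ^ (2 * N + 1)) ^ (1 / (4 * (N:ℝ) + 2))

/-- The polynomial nonlinearity `f(θ) = (∑_{j=0}^{N} b_j |θ|^{2j}) θ`. -/
def polyF (N : ℕ) (b : Fin (N + 1) → ℝ) (v : Fin 2 → ℝ) : Fin 2 → ℝ :=
  fun k => (∑ j : Fin (N + 1), b j * (∑ l : Fin 2, (v l) ^ 2) ^ (j : ℕ)) * v k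

theorem HasCompactSupport.pow_two {α R : Type*} [TopologicalSpace α] [MonoidWithZero R]
    {f : α → R} (hf : HasCompactSupport f) : HasCompactSupport (fun x => f x ^ 2) := by
  simp only [sq]
  exact hf.mul_right

theorem HasCompactSupport.component {α ι : Type*} [TopologicalSpace α] {f : α → ι → ℝ}
    (hf : HasCompactSupport f) (i : ι) : HasCompactSupport (fun x => f x i) :=
  hf.comp_left (g := fun y : ι → ℝ => y i) rfl

/-- The Cauchy–Schwarz inequality for integrals of products of real-valued functions. -/
theorem sq_integral_mul_le {α : Type*} [MeasurableSpace α] {μ : Measure α} {f g : α → ℝ}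
    (hf : Integrable (fun x => f x ^ 2) μ) (hg : Integrable (fun x => g x ^ 2) μ)
    (hfg : Integrable (fun x => f x * g x) μ) :
    (∫ x, f x * g x ∂μ) ^ 2 ≤ (∫ x, f x ^ 2 ∂μ) * ∫ x, g x ^ 2 ∂μ := by
  have h := discrim_le_zero (a := ∫ x, f x ^ 2 ∂μ) (b := 2 * ∫ x, f x * g x ∂μ)
    (c := ∫ x, g x ^ 2 ∂μ) fun t => by
      have key : 0 ≤ ∫ x, (t * f x + g x) ^ 2 ∂μ := integral_nonneg fun x => sq_nonneg _
      have hexp : (fun x => (t * f x + g x) ^ 2) =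
          fun x => (t * t) * f x ^ 2 + (2 * t) * (f x * g x) + g x ^ 2 := by
        ext x; ring
      rw [hexp, integral_add (f := fun x => (t * t) * f x ^ 2 + (2 * t) * (f x * g x))
        ((hf.const_mul _).add (hfg.const_mul _)) hg,
        integral_add (hf.const_mul _) (hfg.const_mul _), integral_const_mul,
        integral_const_mul] at key
      linarith
  rw [discrim] at h
  linarith

theorem continuous_pderivE {f : (Fin 2 → ℝ) → ℝ} (hf : ContDiff ℝ 1 f) (i : Fin 2) :
    Continuous (pderivE f i) :=
  (hf.continuous_fderiv one_ne_zero).clm_apply continuous_const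

theorem HasCompactSupport.pderivE {f : (Fin 2 → ℝ) → ℝ} (hf : HasCompactSupport f) (i : Fin 2) :
    HasCompactSupport (pderivE f i) :=
  hf.fderiv_apply (𝕜 := ℝ) _

theorem norm_fderiv_le_sum_abs_pderivE (f : (Fin 2 → ℝ) → ℝ) (x : Fin 2 → ℝ) :
    ‖fderiv ℝ f x‖ ≤ ∑ i, |pderivE f i x| := by
  refine ContinuousLinearMap.opNorm_le_bound _ (Finset.sum_nonneg fun _ _ => abs_nonneg _)
    fun v => ?_
  have hv : fderiv ℝ f x v = ∑ i, v i * pderivE f i x := by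
    conv_lhs => rw [pi_eq_sum_univ' v]
    simp [pderivE]
  rw [hv, Real.norm_eq_abs, Finset.sum_mul]
  refine (Finset.abs_sum_le_sum_abs _ _).trans (Finset.sum_le_sum fun i _ => ?_)
  rw [abs_mul, mul_comm]
  gcongr
  exact norm_le_pi_norm v i

theorem sq_norm_fderiv_le (f : (Fin 2 → ℝ) → ℝ) (x : Fin 2 → ℝ) :
    ‖fderiv ℝ f x‖ ^ 2 ≤ 2 * ∑ i, pderivE f i x ^ 2 := by
  refine (pow_le_pow_left₀ (norm_nonneg _) (norm_fderiv_le_sum_abs_pderivE f x) 2).trans ?_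
  rw [Fin.sum_univ_two, Fin.sum_univ_two, ← sq_abs (pderivE f 0 x), ← sq_abs (pderivE f 1 x)]
  nlinarith [sq_nonneg (|pderivE f 0 x| - |pderivE f 1 x|)]

/-- The two-dimensional Gagliardo–Nirenberg–Sobolev inequality `‖f‖₂ ≤ ‖Df‖₁`. -/
theorem integral_sq_le_sq_integral_norm_fderiv {f : (Fin 2 → ℝ) → ℝ} (hf : ContDiff ℝ 1 f)
    (hc : HasCompactSupport f) :
    ∫ x, f x ^ 2 ≤ (∫ x, ‖fderiv ℝ f x‖) ^ 2 := by
  have hp : Real.HolderConjugate (Fintype.card (Fin 2)) 2 := by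
    rw [Fintype.card_fin]; exact_mod_cast Real.HolderConjugate.two_two
  have h := lintegral_pow_le_pow_lintegral_fderiv_aux hp hf hc
  have hint : Integrable (fderiv ℝ f) :=
    (hf.continuous_fderiv one_ne_zero).integrable_of_hasCompactSupport (hc.fderiv (𝕜 := ℝ))
  have hsq : Integrable (fun x => f x ^ 2) :=
    (hf.continuous.pow 2).integrable_of_hasCompactSupport hc.pow_two
  have hl : ∫⁻ x, ‖f x‖ₑ ^ (2 : ℝ) = ENNReal.ofReal (∫ x, f x ^ 2) := by
    rw [ofReal_integral_eq_lintegral_ofReal hsq (.of_forall fun x => sq_nonneg _)]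
    refine lintegral_congr fun x => ?_
    rw [ENNReal.rpow_two, ← sq_abs, ENNReal.ofReal_pow (abs_nonneg _), ← Real.norm_eq_abs,
      ofReal_norm]
  rw [hl, ← ofReal_integral_norm_eq_lintegral_enorm hint, ENNReal.rpow_two,
    ← ENNReal.ofReal_pow (integral_nonneg fun _ => norm_nonneg _)] at h
  exact (ENNReal.ofReal_le_ofReal_iff (by positivity)).1 h

/-- Ladyzhenskaya's inequality on `ℝ²`. -/
theorem integral_pow_four_le {f : (Fin 2 → ℝ) → ℝ} (hf : ContDiff ℝ 1 f)
    (hc : HasCompactSupport f) :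
    ∫ x, f x ^ 4 ≤ 8 * (∫ x, f x ^ 2) * ∫ x, ∑ i, pderivE f i x ^ 2 := by
  have hD : Continuous (fderiv ℝ f) := hf.continuous_fderiv one_ne_zero
  have hcD : HasCompactSupport (fderiv ℝ f) := hc.fderiv (𝕜 := ℝ)
  have hnorm : Integrable (fun x => ‖fderiv ℝ f x‖ ^ 2) :=
    (hD.norm.pow 2).integrable_of_hasCompactSupport
      hcD.norm.pow_two
  have hsq : Integrable (fun x => |f x| ^ 2) :=
    (hf.continuous.abs.pow 2).integrable_of_hasCompactSupport
      hc.norm.pow_two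
  have hmul : Integrable (fun x => |f x| * ‖fderiv ℝ f x‖) :=
    (hf.continuous.abs.mul hD.norm).integrable_of_hasCompactSupport
      hc.norm.mul_right
  have hgrad : Integrable (fun x => ∑ i, pderivE f i x ^ 2) :=
    integrable_finsetSum _ fun i _ =>
      ((continuous_pderivE hf i).pow 2).integrable_of_hasCompactSupport
        (hc.pderivE i).pow_two
  have hder (x) : ‖fderiv ℝ (fun y => f y ^ 2) x‖ = 2 * (|f x| * ‖fderiv ℝ f x‖) := by
    rw [((hf.differentiable one_ne_zero x).hasFDerivAt.pow 2).fderiv]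
    simp [norm_smul, mul_assoc]
  calc ∫ x, f x ^ 4 = ∫ x, (f x ^ 2) ^ 2 := by simp only [← pow_mul]
    _ ≤ (∫ x, ‖fderiv ℝ (fun y => f y ^ 2) x‖) ^ 2 :=
      integral_sq_le_sq_integral_norm_fderiv (hf.pow 2)
        hc.pow_two
    _ = 4 * (∫ x, |f x| * ‖fderiv ℝ f x‖) ^ 2 := by
      simp only [hder, integral_const_mul]; ring
    _ ≤ 4 * ((∫ x, f x ^ 2) * ∫ x, ‖fderiv ℝ f x‖ ^ 2) := by
      have := sq_integral_mul_le hsq hnorm hmul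
      simp only [sq_abs] at this
      gcongr
    _ ≤ 4 * ((∫ x, f x ^ 2) * ∫ x, 2 * ∑ i, pderivE f i x ^ 2) := by
      have := integral_mono hnorm (hgrad.const_mul 2) (sq_norm_fderiv_le f)
      gcongr
    _ = 8 * (∫ x, f x ^ 2) * ∫ x, ∑ i, pderivE f i x ^ 2 := by
      rw [integral_const_mul]; ring

/-- Hölder's inequality with exponents `4, 2, 4`, combined with Young's inequality. -/
theorem abs_integral_mul_mul_le {f g h : (Fin 2 → ℝ) → ℝ} (hf : Continuous f)
    (hg : Continuous g) (hh : Continuous h) (cf : HasCompactSupport f)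
    (cg : HasCompactSupport g) (ch : HasCompactSupport h) {δ : ℝ} (hδ : 0 < δ) :
    |∫ x, f x * g x * h x| ≤ δ * (∫ x, g x ^ 2) +
      1 / (4 * δ) * √((∫ x, f x ^ 4) * ∫ x, h x ^ 4) := by
  have i4 {k : (Fin 2 → ℝ) → ℝ} (hk : Continuous k) (ck : HasCompactSupport k) :
      Integrable (fun x => (k x ^ 2) ^ 2) :=
    ((hk.pow 2).pow 2).integrable_of_hasCompactSupport
      ck.pow_two.pow_two
  have ifh : Integrable (fun x => f x ^ 2 * h x ^ 2) :=
    ((hf.pow 2).mul (hh.pow 2)).integrable_of_hasCompactSupport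
      cf.pow_two.mul_right
  have ig : Integrable (fun x => g x ^ 2) :=
    (hg.pow 2).integrable_of_hasCompactSupport cg.pow_two
  have ifgh : Integrable (fun x => f x * g x * h x) :=
    ((hf.mul hg).mul hh).integrable_of_hasCompactSupport cf.mul_right.mul_right
  have hcs := sq_integral_mul_le (i4 hf cf) (i4 hh ch) ifh
  simp only [← pow_mul] at hcs
  calc |∫ x, f x * g x * h x| ≤ ∫ x, |f x * g x * h x| := abs_integral_le_integral_abs
    _ ≤ ∫ x, (δ * g x ^ 2 + 1 / (4 * δ) * (f x ^ 2 * h x ^ 2)) := by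
      refine integral_mono ifgh.abs ((ig.const_mul _).add (ifh.const_mul _)) fun x => ?_
      have hy : |g x| * |f x * h x| ≤ δ * |g x| ^ 2 + 1 / (4 * δ) * |f x * h x| ^ 2 := by
        have := mul_nonneg (one_div_nonneg.2 (by positivity : 0 ≤ 4 * δ))
          (sq_nonneg (2 * δ * |g x| - |f x * h x|))
        field_simp at this ⊢
        linarith
      rwa [sq_abs, sq_abs, mul_pow, ← abs_mul, mul_left_comm, ← mul_assoc] at hy
    _ = δ * (∫ x, g x ^ 2) + 1 / (4 * δ) * ∫ x, f x ^ 2 * h x ^ 2 := by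
      rw [integral_add (ig.const_mul _) (ifh.const_mul _), integral_const_mul,
        integral_const_mul]
    _ ≤ _ := by
      gcongr
      exact Real.le_sqrt_of_sq_le hcs

/-- Antisymmetry of the trilinear form in its last two arguments. -/
theorem formB_eq_neg_formB_swap {u v w : (Fin 2 → ℝ) → (Fin 2 → ℝ)} (hu : ContDiff ℝ 1 u)
    (cu : HasCompactSupport u) (hdiv : DivergenceFree u) (hv : ContDiff ℝ 1 v)
    (hw : ContDiff ℝ 1 w) :
    formB u v w = -formB u w v := by
  have hu' (i) : ContDiff ℝ 1 (fun x => u x i) := contDiff_pi.1 hu i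
  have hv' (i) : ContDiff ℝ 1 (fun x => v x i) := contDiff_pi.1 hv i
  have hw' (i) : ContDiff ℝ 1 (fun x => w x i) := contDiff_pi.1 hw i
  have cu' (i) : HasCompactSupport (fun x => u x i) := cu.component i
  have int1 {a b : (Fin 2 → ℝ) → (Fin 2 → ℝ)} (ha : ContDiff ℝ 1 a) (hb : ContDiff ℝ 1 b)
      (i j : Fin 2) :
      Integrable (fun x => u x i * pderivE (fun y => a y j) i x * b x j) :=
    (((hu' i).continuous.mul (continuous_pderivE (contDiff_pi.1 ha j) i)).mul
      (contDiff_pi.1 hb j).continuous).integrable_of_hasCompactSupport (cu' i).mul_right.mul_right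
  have int2 (i j : Fin 2) :
      Integrable (fun x => pderivE (fun y => u y i) i x * (v x j * w x j)) :=
    ((continuous_pderivE (hu' i) i).mul
      ((hv' j).continuous.mul (hw' j).continuous)).integrable_of_hasCompactSupport
      ((cu' i).pderivE i).mul_right
  have hprod (i j x) : fderiv ℝ (fun y => u y i * w y j) x (Pi.single i 1) =
      u x i * pderivE (fun y => w y j) i x + pderivE (fun y => u y i) i x * w x j := by
    rw [fderiv_fun_mul ((hu' i).differentiable one_ne_zero x)
      ((hw' j).differentiable one_ne_zero x)]
    simp [pderivE, mul_comm]
  have hsplit (i j : Fin 2) : (fun x =>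
      fderiv ℝ (fun y => u y i * w y j) x (Pi.single i 1) * v x j) =
      fun x => u x i * pderivE (fun y => w y j) i x * v x j +
        pderivE (fun y => u y i) i x * (v x j * w x j) := by
    ext x; rw [hprod]; ring
  have parts (i j : Fin 2) : ∫ x, u x i * pderivE (fun y => v y j) i x * w x j =
      -(∫ x, u x i * pderivE (fun y => w y j) i x * v x j) -
        ∫ x, pderivE (fun y => u y i) i x * (v x j * w x j) := by
    have hcomm : (fun x => u x i * w x j * fderiv ℝ (fun y => v y j) x (Pi.single i 1)) =
        fun x => u x i * pderivE (fun y => v y j) i x * w x j := by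
      ext x; rw [pderivE]; ring
    have h := integral_mul_fderiv_eq_neg_fderiv_mul_of_integrable (μ := volume)
      (f := fun x => u x i * w x j) (g := fun x => v x j) (v := Pi.single i 1)
      (by rw [hsplit]; exact (int1 hw hv i j).add (int2 i j))
      (by rw [hcomm]; exact int1 hv hw i j)
      ((((hu' i).continuous.mul (hw' j).continuous).mul
        (hv' j).continuous).integrable_of_hasCompactSupport (cu' i).mul_right.mul_right)
      (fun x _ => ((hu' i).mul (hw' j)).differentiable one_ne_zero x)
      (fun x _ => (hv' j).differentiable one_ne_zero x)
    rw [hsplit, hcomm, integral_add (int1 hw hv i j) (int2 i j)] at h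
    linarith
  have hzero (j : Fin 2) :
      ∑ i, ∫ x, pderivE (fun y => u y i) i x * (v x j * w x j) = 0 := by
    rw [← integral_finsetSum _ fun i _ => int2 i j]
    simp only [← Finset.sum_mul, hdiv _, zero_mul, integral_zero]
  simp only [formB, parts, Finset.sum_sub_distrib, Finset.sum_neg_distrib]
  rw [Finset.sum_comm (f := fun i j => ∫ x, pderivE (fun y => u y i) i x * (v x j * w x j))]
  simp only [hzero, Finset.sum_const_zero, sub_zero]

theorem l2norm_sq (g : (Fin 2 → ℝ) → (Fin 2 → ℝ)) :
    l2norm g ^ 2 = ∫ x, ∑ k, g x k ^ 2 := by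
  rw [l2norm, ← Real.sqrt_eq_rpow, Real.sq_sqrt]
  exact integral_nonneg fun x => Finset.sum_nonneg fun k _ => sq_nonneg _

theorem gradNorm_sq (g : (Fin 2 → ℝ) → (Fin 2 → ℝ)) :
    gradNorm g ^ 2 = ∫ x, ∑ i, ∑ k, pderivE (fun y => g y k) i x ^ 2 := by
  rw [gradNorm, ← Real.sqrt_eq_rpow, Real.sq_sqrt]
  exact integral_nonneg fun x => Finset.sum_nonneg fun i _ => Finset.sum_nonneg fun k _ =>
    sq_nonneg _

theorem integral_component_sq_le {g : (Fin 2 → ℝ) → (Fin 2 → ℝ)} (hg : Continuous g)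
    (cg : HasCompactSupport g) (k : Fin 2) :
    ∫ x, g x k ^ 2 ≤ l2norm g ^ 2 := by
  have hi (k) : Integrable (fun x => g x k ^ 2) :=
    ((continuous_pi_iff.1 hg k).pow 2).integrable_of_hasCompactSupport
      (cg.component k).pow_two
  rw [l2norm_sq]
  exact integral_mono (hi k) (integrable_finsetSum _ fun k _ => hi k) fun x =>
    Finset.single_le_sum (f := fun k => g x k ^ 2) (fun _ _ => sq_nonneg _) (Finset.mem_univ k)

theorem integrable_pderivE_sq {g : (Fin 2 → ℝ) → (Fin 2 → ℝ)} (hg : ContDiff ℝ 1 g)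
    (cg : HasCompactSupport g) (i k : Fin 2) :
    Integrable (fun x => pderivE (fun y => g y k) i x ^ 2) :=
  ((continuous_pderivE (contDiff_pi.1 hg k) i).pow 2).integrable_of_hasCompactSupport
    ((cg.component k).pderivE i).pow_two

theorem integral_component_grad_sq_le {g : (Fin 2 → ℝ) → (Fin 2 → ℝ)} (hg : ContDiff ℝ 1 g)
    (cg : HasCompactSupport g) (k : Fin 2) :
    ∫ x, ∑ i, pderivE (fun y => g y k) i x ^ 2 ≤ gradNorm g ^ 2 := by
  have hi := integrable_pderivE_sq hg cg
  rw [gradNorm_sq]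
  refine integral_mono (integrable_finsetSum _ fun i _ => hi i k)
    (integrable_finsetSum _ fun i _ => integrable_finsetSum _ fun k _ => hi i k) fun x =>
    Finset.sum_le_sum fun i _ => ?_
  exact Finset.single_le_sum (f := fun k => pderivE (fun y => g y k) i x ^ 2)
    (fun _ _ => sq_nonneg _) (Finset.mem_univ k)

theorem integral_pderivE_sq_le {g : (Fin 2 → ℝ) → (Fin 2 → ℝ)} (hg : ContDiff ℝ 1 g)
    (cg : HasCompactSupport g) (i k : Fin 2) :
    ∫ x, pderivE (fun y => g y k) i x ^ 2 ≤ gradNorm g ^ 2 := by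
  have hi := integrable_pderivE_sq hg cg
  refine le_trans ?_ (integral_component_grad_sq_le hg cg k)
  exact integral_mono (hi i k) (integrable_finsetSum _ fun i _ => hi i k) fun x =>
    Finset.single_le_sum (f := fun i => pderivE (fun y => g y k) i x ^ 2)
      (fun _ _ => sq_nonneg _) (Finset.mem_univ i)

theorem integral_component_pow_four_le {g : (Fin 2 → ℝ) → (Fin 2 → ℝ)} (hg : ContDiff ℝ 1 g)
    (cg : HasCompactSupport g) (k : Fin 2) :
    ∫ x, g x k ^ 4 ≤ 8 * l2norm g ^ 2 * gradNorm g ^ 2 := by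
  refine (integral_pow_four_le (contDiff_pi.1 hg k)
    (cg.component k)).trans ?_
  gcongr
  · exact integral_component_sq_le hg.continuous cg k
  · exact integral_component_grad_sq_le hg cg k

/-- the uniqueness-proof estimate
`|b(u,u₁,u)| ≤ κ‖∇u‖₂² + C(κ)‖u₁‖₂²‖∇u₁‖₂²‖u‖₂²`. -/
theorem formB_uniqueness_estimate :
    ∀ κ > (0:ℝ), ∃ C > (0:ℝ), ∀ u u₁ : (Fin 2 → ℝ) → (Fin 2 → ℝ),
      ContDiff ℝ (⊤ : ℕ∞) u → HasCompactSupport u → DivergenceFree u →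
      ContDiff ℝ (⊤ : ℕ∞) u₁ → HasCompactSupport u₁ →
      |formB u u₁ u| ≤
        κ * (gradNorm u) ^ 2 + C * (l2norm u₁) ^ 2 * (gradNorm u₁) ^ 2 * (l2norm u) ^ 2 := by
  intro κ hκ
  refine ⟨2048 / κ ^ 3, by positivity, fun u v hu cu hdiv hv cv => ?_⟩
  have hu : ContDiff ℝ 1 u := hu.of_le (by exact_mod_cast le_top)
  have hv : ContDiff ℝ 1 v := hv.of_le (by exact_mod_cast le_top)
  set G := gradNorm u ^ 2
  set M := l2norm v ^ 2 * gradNorm v ^ 2 * l2norm u ^ 2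
  have hG : 0 ≤ G := sq_nonneg _
  have hM : 0 ≤ M := by positivity
  have hterm (i j : Fin 2) : |∫ x, u x i * pderivE (fun y => u y j) i x * v x j| ≤
      κ / 4 * G + 512 / κ ^ 3 * M := by
    have cu' (k) : HasCompactSupport (fun x => u x k) := cu.component k
    have hsqrt : √((∫ x, u x i ^ 4) * ∫ x, v x j ^ 4) ≤ κ ^ 2 / 16 * G + 256 / κ ^ 2 * M := by
      refine Real.sqrt_le_iff.2 ⟨by positivity, ?_⟩
      calc (∫ x, u x i ^ 4) * ∫ x, v x j ^ 4
          ≤ (8 * l2norm u ^ 2 * gradNorm u ^ 2) * (8 * l2norm v ^ 2 * gradNorm v ^ 2) := by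
            gcongr
            · exact integral_component_pow_four_le hu cu i
            · exact integral_component_pow_four_le hv cv j
        _ = 4 * (κ ^ 2 / 16 * G) * (256 / κ ^ 2 * M) := by
            simp only [G, M]; field_simp; ring
        _ ≤ (κ ^ 2 / 16 * G + 256 / κ ^ 2 * M) ^ 2 := four_mul_le_sq_add _ _
    calc |∫ x, u x i * pderivE (fun y => u y j) i x * v x j|
        ≤ κ / 8 * (∫ x, pderivE (fun y => u y j) i x ^ 2) +
            1 / (4 * (κ / 8)) * √((∫ x, u x i ^ 4) * ∫ x, v x j ^ 4) :=
          abs_integral_mul_mul_le (contDiff_pi.1 hu i).continuous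
            (continuous_pderivE (contDiff_pi.1 hu j) i) (contDiff_pi.1 hv j).continuous
            (cu' i) ((cu' j).pderivE i) (cv.component j) (by positivity)
      _ ≤ κ / 8 * G + 1 / (4 * (κ / 8)) * (κ ^ 2 / 16 * G + 256 / κ ^ 2 * M) := by
          gcongr
          exact integral_pderivE_sq_le hu cu i j
      _ = κ / 4 * G + 512 / κ ^ 3 * M := by field_simp; ring
  rw [formB_eq_neg_formB_swap hu cu hdiv hv hu, abs_neg, formB]
  calc |∑ i, ∑ j, ∫ x, u x i * pderivE (fun y => u y j) i x * v x j|
      ≤ ∑ i, ∑ j, |∫ x, u x i * pderivE (fun y => u y j) i x * v x j| :=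
        (Finset.abs_sum_le_sum_abs _ _).trans
          (Finset.sum_le_sum fun i _ => Finset.abs_sum_le_sum_abs _ _)
    _ ≤ ∑ _i : Fin 2, ∑ _j : Fin 2, (κ / 4 * G + 512 / κ ^ 3 * M) :=
        Finset.sum_le_sum fun i _ => Finset.sum_le_sum fun j _ => hterm i j
    _ = κ * G + 2048 / κ ^ 3 * l2norm v ^ 2 * gradNorm v ^ 2 * l2norm u ^ 2 := by
        simp [M]; ring

end
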